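/- arXiv:1205.2718 — 5 statements merged into one kernel-verified Lean document; each statement's English description precedes it below -/
import Mathlib

section
/- For every integer q ≥ 3 there exists a constant C > 0 (depending only on q) such that for all integers d ≥ 2 and n ≥ d+1 and every simple n-vertex d-regular graph G, the number of proper q-colorings of G satisfies c_q(G) ≤ η(q)^{n/2} · m(q)^{n/(2d) + C·n·√(log d)/d^{3/2}}. -/
/-- The number of proper `q`-colorings of a graph `G`. -/
noncomputable def numColorings {V : Type*} (G : SimpleGraph V) (q : ℕ) : ℕ :=
  Nat.card {f : V → Fin q // ∀ v w, G.Adj v w → f v ≠ f w}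

/-- `η(q) = ⌊q/2⌋ ⌈q/2⌉`, which is `q²/4` for even `q` and `(q²-1)/4` for odd `q`. -/
def eta (q : ℕ) : ℕ := (q / 2) * ((q + 1) / 2)

/-- `m(q)`: `C(q, q/2)` for even `q` and `C(q+1, (q+1)/2)` for odd `q`. -/
def mq (q : ℕ) : ℕ :=
  if Even q then Nat.choose q (q / 2) else Nat.choose (q + 1) ((q + 1) / 2)

open MeasureTheory Finset
open scoped ENNReal

section Elimination

variable {V : Type*} [Fintype V] [DecidableEq V] {q : ℕ}

lemma pi_count_eq_count {ι : Type*} [Fintype ι] :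
    (Measure.pi fun _ : ι => (Measure.count : Measure (Fin q))) = Measure.count := by
  refine Measure.ext_of_singleton fun x => ?_
  rw [Measure.pi_singleton]
  simp

/-- The indicator that the color of `v` differs from the colors of the vertices in `P v`. -/
noncomputable def avoidIndicator (P : V → Finset V) (v : V) (x : V → Fin q) : ℝ≥0∞ :=
  if ∀ u ∈ P v, x v ≠ x u then 1 else 0

/-- The number of colors not used on `S`. -/
noncomputable def numAvail (S : Finset V) (x : V → Fin q) : ℕ :=
  #{c : Fin q | ∀ u ∈ S, c ≠ x u}

lemma lmarginal_count_mul {s : Finset V} {g f : (V → Fin q) → ℝ≥0∞}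
    (hg : ∀ x y, (∀ i ∉ s, x i = y i) → g x = g y) (x : V → Fin q) :
    lmarginal (fun _ => Measure.count) s (fun y => g y * f y) x =
      g x * lmarginal (fun _ => Measure.count) s f x := by
  unfold lmarginal
  rw [← lintegral_const_mul _ (measurable_of_finite _)]
  refine lintegral_congr fun y => ?_
  dsimp only
  congr 1
  refine hg _ _ fun i hi => ?_
  simp [Function.updateFinset, hi]

/-- Successive elimination of the vertices with Hölder's inequality. -/
theorem lmarginal_prod_avoidIndicator_le {d : ℕ} (hd : 0 < d) (P : V → Finset V) (r : V → ℕ)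
    (hr : ∀ v, ∀ u ∈ P v, r u < r v)
    (hP : ∀ w, #(P w) + #{v | w ∈ P v} = d) (U : Finset V)
    (hU : ∀ w ∈ U, ∀ v, w ∈ P v → v ∈ U) (x : V → Fin q) :
    lmarginal (fun _ => Measure.count) U (fun y => ∏ v ∈ U, avoidIndicator P v y) x ≤
      ∏ v ∈ U, (lmarginal (fun _ => Measure.count) (U ∩ P v)
        (fun y => (numAvail (P v) y : ℝ≥0∞) ^ #(P v)) x) ^ (1 / d : ℝ) := by
  induction U using Finset.induction_on_min_value r generalizing x with
  | empty => simp
  | insert a s ha hmin ih =>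
  have hs : ∀ w ∈ s, ∀ v, w ∈ P v → v ∈ s := by
    intro w hw v hv
    rcases mem_insert.1 (hU w (mem_insert_of_mem hw) v hv) with rfl | h
    · exact absurd (hr _ _ hv) (not_lt.2 (hmin w hw))
    · exact h
  specialize ih hs
  have hPs : ∀ u ∈ P a, u ∉ s := fun u hu hus => absurd (hr _ _ hu) (not_lt.2 (hmin u hus))
  have haP : a ∉ P a := fun h => lt_irrefl _ (hr _ _ h)
  have hd0 : (d : ℝ) ≠ 0 := by positivity
  rw [lmarginal_insert _ (measurable_of_finite _) ha]
  simp_rw [prod_insert ha]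
  set Φ : V → (V → Fin q) → ℝ≥0∞ := fun v => lmarginal (fun _ => Measure.count) (s ∩ P v)
        (fun y => (numAvail (P v) y : ℝ≥0∞) ^ #(P v)) with hΦ
  have hind : ∀ y z : V → Fin q, (∀ i ∉ s, y i = z i) →
      avoidIndicator P a y = avoidIndicator P a z := by
    intro y z h
    unfold avoidIndicator
    rw [h a ha]
    congr 1
    refine propext (forall₂_congr fun u hu => ?_)
    rw [h u (hPs u hu)]
  have hnb : ({v | a ∈ P v} : Finset V) ⊆ s := by
    intro v hv
    have hv := (mem_filter.1 hv).2
    rcases mem_insert.1 (hU a (mem_insert_self _ _) v hv) with rfl | h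
    · exact absurd hv haP
    · exact h
  set N : Finset V := {v | a ∈ P v} with hN
  have hΦN : ∀ v ∈ s \ N, ∀ c, Φ v (Function.update x a c) = Φ v x := by
    intro v hv c
    have hav : a ∉ P v := by simpa [hN] using (mem_sdiff.1 hv).2
    have hni : a ∉ s ∩ P v := fun h => ha (mem_inter.1 h).1
    rw [hΦ]
    dsimp only
    rw [lmarginal_update_of_notMem (measurable_of_finite _) hni]
    congr 1
    funext y
    simp only [Function.comp, numAvail]
    congr 3
    refine filter_congr fun e _ => forall₂_congr fun u hu => ?_
    rw [Function.update_of_ne (by rintro rfl; exact hav hu)]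
  have hsum : ∀ v ∈ N, ∫⁻ c, Φ v (Function.update x a c) ∂Measure.count =
      lmarginal (fun _ => Measure.count) (insert a s ∩ P v)
        (fun y => (numAvail (P v) y : ℝ≥0∞) ^ #(P v)) x := by
    intro v hv
    have hav : a ∈ P v := by simpa [hN] using hv
    have hni : a ∉ s ∩ P v := fun h => ha (mem_inter.1 h).1
    rw [insert_inter_of_mem hav, lmarginal_insert _ (measurable_of_finite _) hni]
  have hsumN : ∀ v ∈ s \ N, Φ v x = lmarginal (fun _ => Measure.count) (insert a s ∩ P v)
        (fun y => (numAvail (P v) y : ℝ≥0∞) ^ #(P v)) x := by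
    intro v hv
    have hav : a ∉ P v := by simpa [hN] using (mem_sdiff.1 hv).2
    rw [insert_inter_of_notMem hav]
  have ha0 : ∫⁻ c, avoidIndicator P a (Function.update x a c) ∂Measure.count =
      (numAvail (P a) x : ℝ≥0∞) := by
    rw [lintegral_count, tsum_fintype]
    unfold avoidIndicator numAvail
    simp only [Function.update_self]
    rw [sum_boole]
    congr 2
    refine filter_congr fun e _ => forall₂_congr fun u hu => ?_
    rw [Function.update_of_ne (by rintro rfl; exact haP hu)]
  have hemp : insert a s ∩ P a = ∅ := by
    rw [insert_inter_of_notMem haP]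
    exact disjoint_iff_inter_eq_empty.1 (disjoint_left.2 fun u hu hu' => hPs u hu' hu)
  calc ∫⁻ c, lmarginal (fun _ => Measure.count) s
          (fun y => avoidIndicator P a y * ∏ v ∈ s, avoidIndicator P v y)
          (Function.update x a c) ∂Measure.count
      ≤ ∫⁻ c, (∏ v ∈ s \ N, Φ v x ^ (1 / d : ℝ)) *
          (avoidIndicator P a (Function.update x a c) ^ (#(P a) / d : ℝ) *
          ∏ v ∈ N, Φ v (Function.update x a c) ^ (1 / d : ℝ)) ∂Measure.count := by
        refine lintegral_mono fun c => ?_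
        dsimp only
        rw [lmarginal_count_mul hind]
        calc _ ≤ avoidIndicator P a (Function.update x a c) ^ (#(P a) / d : ℝ) *
              ∏ v ∈ s, Φ v (Function.update x a c) ^ (1 / d : ℝ) := by
              refine mul_le_mul' ?_ (ih _)
              unfold avoidIndicator
              split_ifs <;> simp
          _ = _ := by
              rw [← prod_sdiff hnb, prod_congr rfl fun v hv => by rw [hΦN v hv c]]
              ring
    _ = (∏ v ∈ s \ N, Φ v x ^ (1 / d : ℝ)) *
          ∫⁻ c, avoidIndicator P a (Function.update x a c) ^ (#(P a) / d : ℝ) *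
          ∏ v ∈ N, Φ v (Function.update x a c) ^ (1 / d : ℝ) ∂Measure.count := by
        rw [lintegral_const_mul _ (measurable_of_finite _)]
    _ ≤ (∏ v ∈ s \ N, Φ v x ^ (1 / d : ℝ)) *
          ((∫⁻ c, avoidIndicator P a (Function.update x a c) ∂Measure.count) ^ (#(P a) / d : ℝ) *
          ∏ v ∈ N, (∫⁻ c, Φ v (Function.update x a c) ∂Measure.count) ^ (1 / d : ℝ)) := by
        gcongr
        refine ENNReal.lintegral_mul_prod_norm_pow_le N (q := #(P a) / d) (p := fun _ => 1 / d)
          (measurable_of_finite _).aemeasurable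
          (fun i _ => (measurable_of_finite _).aemeasurable) ?_ (by positivity)
          (fun i _ => by positivity)
        rw [sum_const, nsmul_eq_mul, ← hP a]
        push_cast
        rw [← hN]
        have : (#(P a) : ℝ) + #N ≠ 0 := by rw [← hP a] at hd0; push_cast at hd0; exact hd0
        field_simp
    _ = _ := by
        have hprodN := prod_congr rfl fun v hv =>
          congrArg (fun t : ℝ≥0∞ => t ^ (1 / d : ℝ)) (hsum v hv)
        have hprod := prod_congr rfl fun v hv =>
          congrArg (fun t : ℝ≥0∞ => t ^ (1 / d : ℝ)) (hsumN v hv)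
        rw [ha0, hemp, lmarginal_empty, ← prod_sdiff hnb, hprodN, hprod, ← ENNReal.rpow_natCast,
          ← ENNReal.rpow_mul, mul_one_div]
        ring

end Elimination

section BipartitePieces

variable {q : ℕ}

lemma sum_image_compl_pow_le {ι : Type*} [Fintype ι] [DecidableEq ι] :
    ∑ y : ι → Fin q, #(univ.image y)ᶜ ^ Fintype.card ι ≤
      ∑ A : Finset (Fin q), (#A * (q - #A)) ^ Fintype.card ι := by
  rw [← sum_fiberwise (s := univ) (g := fun y : ι → Fin q => univ.image y)]
  refine sum_le_sum fun A _ => ?_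
  calc _ = ∑ y : ι → Fin q with univ.image y = A, #Aᶜ ^ Fintype.card ι :=
        sum_congr rfl fun y hy => by rw [(mem_filter.1 hy).2]
    _ ≤ ∑ y ∈ Fintype.piFinset fun _ : ι => A, #Aᶜ ^ Fintype.card ι := by
        refine sum_le_sum_of_subset fun y hy => ?_
        rw [Fintype.mem_piFinset]
        intro i
        rw [← (mem_filter.1 hy).2]
        exact mem_image_of_mem _ (mem_univ _)
    _ = _ := by
        rw [sum_const, Fintype.card_piFinset, prod_const, card_univ, card_compl, Fintype.card_fin, smul_eq_mul,
          mul_pow]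

lemma mul_sub_le_eta {k : ℕ} (hk : k ≤ q) : k * (q - k) ≤ eta q := by
  obtain ⟨j, rfl⟩ := Nat.exists_eq_add_of_le hk
  rw [Nat.add_sub_cancel_left, eta]
  rcases Nat.even_or_odd' (k + j) with ⟨b, hb | hb⟩
  · rw [hb, show 2 * b / 2 = b by omega, show (2 * b + 1) / 2 = b by omega]
    zify at hb ⊢
    nlinarith [sq_nonneg ((k : ℤ) - j)]
  · rw [hb, show (2 * b + 1) / 2 = b by omega, show (2 * b + 1 + 1) / 2 = b + 1 by omega]
    rcases le_total k b with h | h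
    · obtain ⟨t, rfl⟩ := Nat.exists_eq_add_of_le h
      have : j = k + 2 * t + 1 := by omega
      subst this
      nlinarith
    · have h' : j ≤ b + 1 := by omega
      rcases Nat.eq_or_lt_of_le h' with h'' | h''
      · have : k = b := by omega
        subst this; subst h''; exact le_rfl
      · obtain ⟨t, ht⟩ := Nat.exists_eq_add_of_le (Nat.lt_succ_iff.1 h'')
        subst ht
        have : k = j + 2 * t + 1 := by omega
        subst this
        nlinarith

lemma eq_half_of_mul_sub_eq_eta {k : ℕ} (hk : k ≤ q) (h : k * (q - k) = eta q) :
    k = q / 2 ∨ k = (q + 1) / 2 := by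
  obtain ⟨j, rfl⟩ := Nat.exists_eq_add_of_le hk
  rw [Nat.add_sub_cancel_left, eta] at h
  rcases Nat.even_or_odd' (k + j) with ⟨b, hb | hb⟩
  · rw [hb, show 2 * b / 2 = b by omega, show (2 * b + 1) / 2 = b by omega] at h
    rw [hb]
    have : ((k : ℤ) - b) ^ 2 = 0 := by zify at hb h; nlinarith
    have : (k : ℤ) - b = 0 := by simpa using this
    omega
  · rw [hb, show (2 * b + 1) / 2 = b by omega, show (2 * b + 1 + 1) / 2 = b + 1 by omega] at h
    rw [hb]
    have : ((k : ℤ) - b) * (k - (b + 1)) = 0 := by zify at hb h; nlinarith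
    rcases mul_eq_zero.1 this with h | h <;> omega

lemma card_filter_eq_eta_le : #{A : Finset (Fin q) | #A * (q - #A) = eta q} ≤ mq q := by
  have hsub : ({A : Finset (Fin q) | #A * (q - #A) = eta q} : Finset (Finset (Fin q))) ⊆
      powersetCard (q / 2) univ ∪ powersetCard ((q + 1) / 2) univ := by
    intro A hA
    have hA' := eq_half_of_mul_sub_eq_eta (by simpa using card_le_univ A) (mem_filter.1 hA).2
    simpa [mem_powersetCard] using hA'
  refine (card_le_card hsub).trans ?_
  rw [mq]
  rcases Nat.even_or_odd' q with ⟨b, hb | hb⟩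
  · rw [if_pos (by rw [hb]; simp), show (q + 1) / 2 = q / 2 by omega, union_idempotent,
      card_powersetCard]
    simp
  · rw [if_neg (by rw [hb]; simp [parity_simps])]
    refine (card_union_le _ _).trans ?_
    rw [card_powersetCard, card_powersetCard, card_univ, Fintype.card_fin,
      show (q + 1) / 2 = q / 2 + 1 by omega, Nat.choose_succ_succ]

lemma sum_card_mul_pow_le (p : ℕ) :
    ∑ A : Finset (Fin q), (#A * (q - #A)) ^ p ≤ mq q * eta q ^ p + 2 ^ q * (eta q - 1) ^ p := by
  rw [← sum_filter_add_sum_filter_not univ (fun A : Finset (Fin q) => #A * (q - #A) = eta q)]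
  gcongr ?_ + ?_
  · calc _ = ∑ A : Finset (Fin q) with #A * (q - #A) = eta q, eta q ^ p :=
          sum_congr rfl fun A hA => by rw [(mem_filter.1 hA).2]
      _ ≤ _ := by
          rw [sum_const, smul_eq_mul]
          exact Nat.mul_le_mul_right _ card_filter_eq_eta_le
  · calc _ ≤ ∑ A : Finset (Fin q) with ¬ #A * (q - #A) = eta q, (eta q - 1) ^ p := by
          refine sum_le_sum fun A hA => Nat.pow_le_pow_left ?_ _
          have h1 := mul_sub_le_eta (q := q) (k := #A) (by simpa using card_le_univ A)
          have h2 := (mem_filter.1 hA).2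
          omega
      _ ≤ _ := by
          rw [sum_const, smul_eq_mul]
          refine Nat.mul_le_mul_right _ ((card_le_univ _).trans ?_)
          simp

lemma one_le_mq : 1 ≤ mq q := by
  rw [mq]
  split_ifs <;> exact Nat.choose_pos (by omega)

lemma two_le_eta (hq : 3 ≤ q) : 2 ≤ eta q :=
  Nat.mul_le_mul (n₁ := 1) (m₁ := 2) (by omega) (by omega)

lemma sum_card_mul_pow_le_exp (hq : 3 ≤ q) (p : ℕ) :
    ((∑ A : Finset (Fin q), (#A * (q - #A)) ^ p : ℕ) : ℝ) ≤
      (eta q : ℝ) ^ p * mq q * Real.exp (2 ^ q * (1 - 1 / eta q : ℝ) ^ p) := by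
  have hη : (2 : ℝ) ≤ eta q := by exact_mod_cast two_le_eta hq
  have hm : (1 : ℝ) ≤ mq q := by exact_mod_cast one_le_mq
  have hρ : (0 : ℝ) ≤ 1 - 1 / eta q := by
    rw [sub_nonneg, div_le_one (by linarith)]; linarith
  have h : ((∑ A : Finset (Fin q), (#A * (q - #A)) ^ p : ℕ) : ℝ) ≤
      mq q * (eta q : ℝ) ^ p + 2 ^ q * ((eta q : ℝ) - 1) ^ p := by
    have := sum_card_mul_pow_le (q := q) p
    have h1 : (((eta q - 1 : ℕ)) : ℝ) = eta q - 1 := by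
      rw [Nat.cast_sub (by linarith [two_le_eta hq])]; simp
    rw [← h1]
    exact_mod_cast this
  refine h.trans ?_
  have h2 : ((eta q : ℝ) - 1) ^ p = (eta q : ℝ) ^ p * (1 - 1 / eta q : ℝ) ^ p := by
    rw [← mul_pow]; congr 1; field_simp
  rw [h2]
  set δ : ℝ := 2 ^ q * (1 - 1 / eta q : ℝ) ^ p with hδ
  have hδ0 : 0 ≤ δ := by positivity
  have h3 := Real.add_one_le_exp δ
  calc _ = (eta q : ℝ) ^ p * (mq q + δ) := by rw [hδ]; ring
    _ ≤ (eta q : ℝ) ^ p * (mq q * (δ + 1)) := by gcongr; nlinarith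
    _ ≤ _ := by rw [mul_assoc]; gcongr

lemma one_sub_inv_pow_le {a : ℝ} (ha : 1 ≤ a) {p : ℕ} (hp : 0 < p) :
    (1 - 1 / a) ^ p ≤ a / p := by
  have ha0 : 0 < a := by linarith
  have h0 : 0 ≤ 1 - 1 / a := by rw [sub_nonneg, div_le_one ha0]; exact ha
  have hB := one_add_mul_le_pow (a := 1 / a) (by have : 0 ≤ 1 / a := by positivity
                                                 linarith) p
  have h1 : ((1 - 1 / a) * (1 + 1 / a)) ^ p ≤ 1 := by
    refine pow_le_one₀ (by positivity) ?_
    have : 0 ≤ (1 / a) ^ 2 := by positivity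
    nlinarith
  rw [mul_pow] at h1
  have hp0 : (0 : ℝ) < p := by exact_mod_cast hp
  rw [le_div_iff₀ hp0]
  have h2 : (1 - 1 / a) ^ p * (p * (1 / a)) ≤ 1 :=
    (mul_le_mul_of_nonneg_left (by linarith) (by positivity)).trans h1
  have h3 := mul_le_mul_of_nonneg_right h2 ha0.le
  calc _ = (1 - 1 / a) ^ p * (p * (1 / a)) * a := by field_simp
    _ ≤ _ := by linarith

variable {V : Type*} [Fintype V] [DecidableEq V]

lemma lmarginal_numAvail_pow_le (S : Finset V) (x : V → Fin q) :
    lmarginal (fun _ => Measure.count) S (fun y => (numAvail S y : ℝ≥0∞) ^ #S) x ≤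
      ((∑ A : Finset (Fin q), (#A * (q - #A)) ^ #S : ℕ) : ℝ≥0∞) := by
  unfold lmarginal
  rw [pi_count_eq_count, lintegral_count, tsum_fintype]
  have h := sum_image_compl_pow_le (q := q) (ι := S)
  rw [Fintype.card_coe] at h
  refine le_trans (le_of_eq ?_) (Nat.cast_le.2 h)
  push_cast
  refine sum_congr rfl fun y _ => ?_
  congr 2
  unfold numAvail
  congr 1
  ext c
  simp only [mem_filter, mem_univ, true_and, mem_compl, mem_image, not_exists]
  constructor
  · rintro h ⟨i, hi⟩ rfl
    exact h i hi (by simp [Function.updateFinset, hi])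
  · rintro h u hu rfl
    exact h ⟨u, hu⟩ (by simp [Function.updateFinset, hu])

end BipartitePieces

section LargeIndependentSet

variable {V : Type*} [Fintype V] [DecidableEq V] {q : ℕ}

/-- An upper bound for the number of `q`-colorings of the complete bipartite graph `K_{p,p}`
with nonempty parts; the value `1` for `p = 0`. -/
def pieceBound (q p : ℕ) : ℕ :=
  if p = 0 then 1 else ∑ A : Finset (Fin q), (#A * (q - #A)) ^ p

lemma pieceBound_le_exp (hq : 3 ≤ q) (p : ℕ) :
    (pieceBound q p : ℝ) ≤
      (eta q : ℝ) ^ p * mq q * Real.exp (2 ^ q * (1 - 1 / eta q : ℝ) ^ p) := by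
  refine le_trans ?_ (sum_card_mul_pow_le_exp hq p)
  rw [pieceBound]
  split_ifs with h0
  · rw [h0]
    simp [one_le_pow₀]
  · exact le_rfl

lemma prod_avoidIndicator {G : SimpleGraph V} [DecidableRel G.Adj] {r : V → ℕ}
    (hr : Function.Injective r) (x : V → Fin q) :
    ∏ v, avoidIndicator (fun v => {u ∈ G.neighborFinset v | r u < r v}) v x =
      if ∀ v w, G.Adj v w → x v ≠ x w then 1 else 0 := by
  unfold avoidIndicator
  rw [prod_boole]
  congr 1
  simp only [mem_univ, mem_filter, SimpleGraph.mem_neighborFinset, true_implies, eq_iff_iff]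
  constructor
  · intro h v w hvw
    rcases lt_trichotomy (r v) (r w) with hlt | heq | hlt
    · exact (h w v ⟨hvw.symm, hlt⟩).symm
    · exact absurd (hr heq) hvw.ne
    · exact h v w ⟨hvw, hlt⟩
  · exact fun h v u hu => h v u hu.1

/-- The number of colorings is bounded by a product over vertices of contributions depending
on the number of preceding neighbors. -/
theorem numColorings_le_prod {G : SimpleGraph V} [DecidableRel G.Adj] {d : ℕ} (hd : 0 < d)
    (hG : G.IsRegularOfDegree d) (hq : 0 < q) {r : V → ℕ} (hr : Function.Injective r) :
    (numColorings G q : ℝ) ≤ ∏ v,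
      (pieceBound q #{u ∈ G.neighborFinset v | r u < r v} : ℝ) ^ (1 / d : ℝ) := by
  classical
  set P : V → Finset V := fun v => {u ∈ G.neighborFinset v | r u < r v} with hPdef
  have x : V → Fin q := fun _ => ⟨0, hq⟩
  have hP : ∀ w, #(P w) + #{v | w ∈ P v} = d := by
    intro w
    rw [← hG w, ← SimpleGraph.card_neighborFinset_eq_degree,
      ← card_filter_add_card_filter_not (s := G.neighborFinset w) (fun u => r u < r w)]
    congr 2
    ext v
    simp only [hPdef, mem_filter, mem_univ, true_and, SimpleGraph.mem_neighborFinset, not_lt]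
    constructor
    · exact fun h => ⟨h.1.symm, h.2.le⟩
    · exact fun h => ⟨h.1.symm, lt_of_le_of_ne h.2 fun h' => h.1.ne (hr h')⟩
  have key := lmarginal_prod_avoidIndicator_le (q := q) hd P r
    (fun v u hu => (mem_filter.1 hu).2) hP univ (fun _ _ _ _ => mem_univ _) x
  rw [lmarginal_univ, pi_count_eq_count, lintegral_count, tsum_fintype] at key
  simp_rw [hPdef, prod_avoidIndicator hr, sum_boole, univ_inter] at key
  have hcard : numColorings G q = #{f : V → Fin q | ∀ v w, G.Adj v w → f v ≠ f w} := by
    rw [numColorings, Nat.card_eq_fintype_card, Fintype.card_subtype]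
  rw [← hcard] at key
  have key2 : (numColorings G q : ℝ≥0∞) ≤ ∏ v,
      (pieceBound q #(P v) : ℝ≥0∞) ^ (1 / d : ℝ) := by
    refine key.trans (prod_le_prod' fun v _ => ?_)
    refine ENNReal.rpow_le_rpow ?_ (by positivity)
    rw [pieceBound]
    split_ifs with h
    · change lmarginal _ (P v) (fun y => (numAvail (P v) y : ℝ≥0∞) ^ #(P v)) x ≤ _
      rw [card_eq_zero.1 h]
      simp
    · exact lmarginal_numAvail_pow_le (P v) x
  have key3 := ENNReal.toReal_mono (ENNReal.prod_ne_top fun v _ =>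
    ENNReal.rpow_ne_top_of_nonneg (by positivity) (ENNReal.natCast_ne_top _)) key2
  rw [ENNReal.toReal_prod, ENNReal.toReal_natCast] at key3
  refine key3.trans (le_of_eq (prod_congr rfl fun v _ => ?_))
  rw [← ENNReal.toReal_rpow, ENNReal.toReal_natCast]

lemma exists_injective_rank_lt (I : Finset V) :
    ∃ r : V → ℕ, Function.Injective r ∧ ∀ u ∈ I, ∀ v ∉ I, r u < r v := by
  let e := Fintype.equivFin V
  refine ⟨fun v => if v ∈ I then e v else Fintype.card V + e v, fun u v huv => ?_, ?_⟩
  · have hu := (e u).2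
    have hv := (e v).2
    refine e.injective (Fin.ext ?_)
    dsimp only at huv
    split_ifs at huv <;> omega
  · intro u hu v hv
    simp only [hu, hv, if_true, if_false]
    exact Nat.lt_add_right _ (e u).2

lemma sum_card_preceding {V : Type*} [Fintype V] {G : SimpleGraph V} [DecidableRel G.Adj] {d : ℕ}
    (hG : G.IsRegularOfDegree d) {r : V → ℕ} (hr : Function.Injective r) :
    ∑ v, (#{u ∈ G.neighborFinset v | r u < r v} : ℝ) = Fintype.card V * d / 2 := by
  set p : V → ℕ := fun v => #{u ∈ G.neighborFinset v | r u < r v} with hp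
  have h1 : ∀ v, p v + #{u ∈ G.neighborFinset v | r v < r u} = d := by
    intro v
    rw [← hG v, ← SimpleGraph.card_neighborFinset_eq_degree,
      ← card_filter_add_card_filter_not (s := G.neighborFinset v) (fun u => r u < r v)]
    congr 2
    refine filter_congr fun u hu => ?_
    rw [SimpleGraph.mem_neighborFinset] at hu
    rw [not_lt]
    exact ⟨le_of_lt, fun h => lt_of_le_of_ne h fun h' => hu.ne (hr h')⟩
  have h2 : ∑ v, #{u ∈ G.neighborFinset v | r v < r u} = ∑ v, p v := by
    have := sum_card_bipartiteAbove_eq_sum_card_bipartiteBelow (s := univ) (t := univ)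
      (fun u v : V => G.Adj u v ∧ r u < r v)
    simp only [bipartiteAbove, bipartiteBelow] at this
    convert this using 3 with v _ v _
    · ext u; simp
    · ext u; simp [G.adj_comm]
  have h3 : ∑ v, p v + ∑ v, p v = Fintype.card V * d := by
    nth_rewrite 2 [← h2]
    rw [← sum_add_distrib, sum_congr rfl fun v _ => h1 v]
    simp
  have h4 : ∑ v, (p v : ℝ) + ∑ v, (p v : ℝ) = Fintype.card V * d := by exact_mod_cast h3
  linarith

lemma sum_compl_card_neighbors {G : SimpleGraph V} [DecidableRel G.Adj] {d : ℕ}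
    (hG : G.IsRegularOfDegree d) {I : Finset V} (hI : ∀ u ∈ I, ∀ v ∈ I, ¬ G.Adj u v) :
    ∑ v ∈ Iᶜ, (#{u ∈ G.neighborFinset v | u ∈ I} : ℝ) = d * #I := by
  have h1 : ∑ v ∈ I, #{u ∈ G.neighborFinset v | u ∈ I} = 0 := by
    refine sum_eq_zero fun v hv => ?_
    rw [card_eq_zero, filter_eq_empty_iff]
    intro u hu huI
    rw [SimpleGraph.mem_neighborFinset] at hu
    exact hI v hv u huI hu
  have h2 : ∑ v, #{u ∈ G.neighborFinset v | u ∈ I} = ∑ u ∈ I, G.degree u := by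
    have := sum_card_bipartiteAbove_eq_sum_card_bipartiteBelow (s := univ) (t := I)
      (fun u v : V => G.Adj u v)
    simp only [bipartiteAbove, bipartiteBelow] at this
    convert this using 3 with v _ v _
    · ext u; simp [and_comm]
    · rw [← SimpleGraph.card_neighborFinset_eq_degree]
      congr 1
      ext u; simp [G.adj_comm]
  rw [← sum_add_sum_compl I, h1, zero_add, sum_congr rfl fun u _ => hG u, sum_const,
    smul_eq_mul] at h2
  rw [mul_comm]
  exact_mod_cast h2

/-- The bound on the number of colorings in the presence of an independent set. -/
theorem numColorings_le_of_isIndepSet {G : SimpleGraph V} [DecidableRel G.Adj] {d : ℕ}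
    (hd : 0 < d) (hG : G.IsRegularOfDegree d) (hq : 3 ≤ q) {I : Finset V}
    (hI : ∀ u ∈ I, ∀ v ∈ I, ¬ G.Adj u v) :
    (numColorings G q : ℝ) ≤ (eta q : ℝ) ^ (Fintype.card V / 2 : ℝ) *
      (mq q : ℝ) ^ ((Fintype.card V - #I) / d : ℝ) *
      Real.exp (2 ^ q / d * (2 * (Fintype.card V - 2 * #I) +
        2 * eta q * Fintype.card V / d)) := by
  obtain ⟨r, hr, hrI⟩ := exists_injective_rank_lt I
  set p : V → ℕ := fun v => #{u ∈ G.neighborFinset v | r u < r v} with hp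
  set n : ℕ := Fintype.card V with hn
  have hη : (2 : ℝ) ≤ eta q := by exact_mod_cast two_le_eta hq
  have hm : (1 : ℝ) ≤ mq q := by exact_mod_cast one_le_mq
  have hη0 : (0 : ℝ) < eta q := by linarith
  have hm0 : (0 : ℝ) < mq q := by linarith
  have hdR : (0 : ℝ) < d := by exact_mod_cast hd
  have hρ : (0 : ℝ) ≤ 1 - 1 / eta q := by
    rw [sub_nonneg, div_le_one (by linarith)]; linarith
  have hρ1 : (1 - 1 / eta q : ℝ) ≤ 1 := by
    have : (0 : ℝ) ≤ 1 / eta q := by positivity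
    linarith
  have hpI : ∀ v ∈ I, p v = 0 := by
    intro v hv
    rw [hp]
    dsimp only
    rw [card_eq_zero, filter_eq_empty_iff]
    intro u hu hlt
    rw [SimpleGraph.mem_neighborFinset] at hu
    by_cases huI : u ∈ I
    · exact hI v hv u huI hu
    · exact absurd (hrI v hv u huI) (not_lt.2 hlt.le)
  have hsum : ∑ v, (p v : ℝ) = n * d / 2 := sum_card_preceding hG hr
  set δ : V → ℝ := fun v => if v ∈ I then 0 else 2 ^ q * (1 - 1 / eta q : ℝ) ^ p v with hδ
  have hW : ∀ v, (pieceBound q (p v) : ℝ) ≤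
      (eta q : ℝ) ^ (p v : ℝ) * (mq q : ℝ) ^ (if v ∈ I then 0 else 1 : ℝ) *
        Real.exp (δ v) := by
    intro v
    by_cases hv : v ∈ I
    · simp [hδ, hv, hpI v hv, pieceBound]
    · simp only [hδ, hv, if_false, Real.rpow_natCast, Real.rpow_one]
      exact pieceBound_le_exp hq (p v)
  have hmain : (numColorings G q : ℝ) ≤ (eta q : ℝ) ^ (n / 2 : ℝ) *
      (mq q : ℝ) ^ ((n - #I) / d : ℝ) * Real.exp ((∑ v, δ v) / d) := by
    refine (numColorings_le_prod hd hG (by omega) hr).trans ?_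
    calc _ ≤ ∏ v, ((eta q : ℝ) ^ (p v : ℝ) * (mq q : ℝ) ^ (if v ∈ I then 0 else 1 : ℝ) *
        Real.exp (δ v)) ^ (1 / d : ℝ) := by
          refine prod_le_prod (fun v _ => by positivity) fun v _ => ?_
          exact Real.rpow_le_rpow (by positivity) (hW v) (by positivity)
      _ = (∏ v, ((eta q : ℝ) ^ (p v : ℝ) * (mq q : ℝ) ^ (if v ∈ I then 0 else 1 : ℝ) *
        Real.exp (δ v))) ^ (1 / d : ℝ) := by
          rw [Real.finsetProd_rpow]
          intro v _
          positivity
      _ = _ := by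
          rw [prod_mul_distrib, prod_mul_distrib, ← Real.exp_sum,
            ← Real.rpow_sum_of_pos hη0, ← Real.rpow_sum_of_pos hm0, hsum,
            Real.mul_rpow (by positivity) (by positivity),
            Real.mul_rpow (by positivity) (by positivity), ← Real.rpow_mul hη0.le,
            ← Real.rpow_mul hm0.le, ← Real.exp_mul]
          congr 3
          · field_simp
          · rw [sum_ite, sum_const_zero, sum_const, filter_not, filter_mem_eq_inter, univ_inter,
              ← compl_eq_univ_sdiff, card_compl, nsmul_eq_mul,
              Nat.cast_sub (card_le_univ I)]
            ring
          · ring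
  refine hmain.trans ?_
  gcongr
  rw [div_eq_inv_mul, div_eq_inv_mul, mul_assoc]
  refine mul_le_mul_of_nonneg_left ?_ (by positivity)
  set degI : V → ℕ := fun v => #{u ∈ G.neighborFinset v | u ∈ I} with hdegI
  have hdegp : ∀ v ∉ I, degI v ≤ p v := by
    intro v hv
    refine card_le_card fun u hu => ?_
    rw [mem_filter] at hu ⊢
    exact ⟨hu.1, hrI u hu.2 v hv⟩
  have hdegd : ∀ v, degI v ≤ d := by
    intro v
    rw [← hG v, ← SimpleGraph.card_neighborFinset_eq_degree]
    exact card_filter_le _ _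
  have hdegsum : ∑ v ∈ Iᶜ, (degI v : ℝ) = d * #I := sum_compl_card_neighbors hG hI
  have hterm : ∀ v ∈ Iᶜ, δ v ≤ 2 ^ q * (2 * (1 - degI v / d) + 2 * eta q / d) := by
    intro v hv
    rw [mem_compl] at hv
    simp only [hδ, hv, if_false]
    refine mul_le_mul_of_nonneg_left ?_ (by positivity)
    have hle : (degI v : ℝ) ≤ d := by exact_mod_cast hdegd v
    by_cases h : 2 * degI v < d
    · have h1 : (degI v / d : ℝ) ≤ 1 / 2 := by
        rw [div_le_iff₀ hdR]
        have : (2 * degI v : ℝ) < d := by exact_mod_cast h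
        linarith
      have h2 : (1 - 1 / eta q : ℝ) ^ p v ≤ 1 := pow_le_one₀ hρ hρ1
      have h3 : (0 : ℝ) ≤ 2 * eta q / d := by positivity
      linarith
    · have hlow : d ≤ 2 * p v := by have := hdegp v hv; omega
      have h1 : (degI v / d : ℝ) ≤ 1 := by rw [div_le_one hdR]; exact hle
      have hp0 : 0 < p v := by omega
      have hp0' : (0 : ℝ) < p v := by exact_mod_cast hp0
      have h2 := one_sub_inv_pow_le (a := eta q) (by linarith) hp0
      have h3 : (eta q / p v : ℝ) ≤ 2 * eta q / d := by
        rw [div_le_div_iff₀ hp0' hdR]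
        have : (d : ℝ) ≤ 2 * p v := by exact_mod_cast hlow
        nlinarith
      linarith
  have hcompl : (#Iᶜ : ℝ) = n - #I := by
    rw [card_compl, Nat.cast_sub (card_le_univ I)]
  calc ∑ v, δ v = ∑ v ∈ Iᶜ, δ v := by
        rw [← sum_add_sum_compl I, sum_eq_zero fun v hv => ?_, zero_add]
        simp [hδ, hv]
    _ ≤ ∑ v ∈ Iᶜ, 2 ^ q * (2 * (1 - degI v / d) + 2 * eta q / d : ℝ) := sum_le_sum hterm
    _ = 2 ^ q * (2 * (n - 2 * #I) + 2 * eta q * (n - #I) / d) := by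
        rw [← mul_sum, sum_add_distrib, ← mul_sum, sum_sub_distrib, ← sum_div, hdegsum, sum_const,
          sum_const, nsmul_eq_mul, nsmul_eq_mul, hcompl]
        field_simp
        ring
    _ ≤ _ := by
        gcongr
        have : (0 : ℝ) ≤ #I := by positivity
        linarith

end LargeIndependentSet

section Containers

variable {V : Type*} [Fintype V] [DecidableEq V] (G : SimpleGraph V) [DecidableRel G.Adj]

/-- The vertices outside the neighborhood `N(T)` with fewer than `φ` neighbors outside `N(T)`. -/
noncomputable def container (φ : ℝ) (T : Finset V) : Finset V :=
  {v | v ∉ (T.biUnion fun u => G.neighborFinset u) ∧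
    (#(G.neighborFinset v \ (T.biUnion fun u => G.neighborFinset u)) : ℝ) < φ}

variable {G}

lemma exists_subset_container {φ : ℝ} (hφ : 0 < φ) {I : Finset V}
    (hI : ∀ u ∈ I, ∀ v ∈ I, ¬ G.Adj u v) :
    ∃ T ⊆ I, φ * #T ≤ Fintype.card V ∧ I ⊆ container G φ T := by
  obtain ⟨T, hT, hmax⟩ := exists_max_image
    {T ∈ I.powerset | φ * #T ≤ #(T.biUnion fun u => G.neighborFinset u)} card ⟨∅, by simp⟩
  rw [mem_filter, mem_powerset] at hT
  refine ⟨T, hT.1, hT.2.trans (by exact_mod_cast card_le_univ _), fun v hv => ?_⟩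
  rw [container, mem_filter]
  refine ⟨mem_univ _, ?_, ?_⟩
  · rw [mem_biUnion]
    rintro ⟨u, hu, huv⟩
    exact hI u (hT.1 hu) v hv ((G.mem_neighborFinset _ _).1 huv)
  · by_contra! hcon
    have hvT : v ∉ T := by
      intro hvT
      have : G.neighborFinset v \ (T.biUnion fun u => G.neighborFinset u) = ∅ :=
        sdiff_eq_empty_iff_subset.2 (subset_biUnion_of_mem (fun u => G.neighborFinset u) hvT)
      rw [this] at hcon
      simp at hcon
      linarith
    have h := hmax (insert v T) (by
      rw [mem_filter, mem_powerset]
      refine ⟨insert_subset hv hT.1, ?_⟩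
      rw [biUnion_insert, ← sdiff_union_self_eq_union, card_union_of_disjoint sdiff_disjoint,
        card_insert_of_notMem hvT]
      push_cast
      linarith [hT.2])
    rw [card_insert_of_notMem hvT] at h
    omega

lemma card_container_mul_le {d : ℕ} (hG : G.IsRegularOfDegree d) (φ : ℝ) (T : Finset V) :
    #(container G φ T) * (2 * d - φ) ≤ d * Fintype.card V := by
  set N := T.biUnion fun u => G.neighborFinset u with hN
  set C := container G φ T with hC
  have hdisj : #C + #N ≤ Fintype.card V := by
    rw [← card_union_of_disjoint]
    · exact card_le_univ _
    · exact disjoint_left.2 fun v hv => (mem_filter.1 hv).2.1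
  have hlow : ∀ v ∈ C, (d : ℝ) - φ ≤ #{u ∈ N | G.Adj v u} := by
    intro v hv
    have h1 := (mem_filter.1 hv).2.2
    have h2 := card_sdiff_add_card_inter (G.neighborFinset v) N
    rw [SimpleGraph.card_neighborFinset_eq_degree, hG v] at h2
    have h3 : G.neighborFinset v ∩ N = {u ∈ N | G.Adj v u} := by ext; simp [and_comm]
    rw [h3] at h2
    have h4 : (#(G.neighborFinset v \ N) : ℝ) + #{u ∈ N | G.Adj v u} = d := by exact_mod_cast h2
    linarith
  have hdc : ∑ v ∈ C, #{u ∈ N | G.Adj v u} ≤ #N * d := by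
    have := sum_card_bipartiteAbove_eq_sum_card_bipartiteBelow (s := C) (t := N) G.Adj
    simp only [bipartiteAbove, bipartiteBelow] at this
    rw [this, ← smul_eq_mul]
    refine sum_le_card_nsmul _ _ _ fun u _ => ?_
    rw [← hG u, ← SimpleGraph.card_neighborFinset_eq_degree]
    exact card_le_card fun v hv => by simpa [G.adj_comm] using (mem_filter.1 hv).2
  have h1 : #C * ((d : ℝ) - φ) ≤ #N * d := by
    calc #C * ((d : ℝ) - φ) = ∑ v ∈ C, ((d : ℝ) - φ) := by rw [sum_const, nsmul_eq_mul]
      _ ≤ ∑ v ∈ C, (#{u ∈ N | G.Adj v u} : ℝ) := sum_le_sum hlow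
      _ ≤ _ := by exact_mod_cast hdc
  have h2 : (#C : ℝ) + #N ≤ Fintype.card V := by exact_mod_cast hdisj
  have h3 : (0 : ℝ) ≤ d := by positivity
  nlinarith

lemma card_filter_small_le {V : Type*} [Fintype V] {φ : ℝ} (hφ : 1 ≤ φ) :
    (#{T : Finset V | φ * #T ≤ Fintype.card V} : ℝ) ≤
      Real.exp (Fintype.card V / φ * (1 + Real.log φ)) := by
  set n := Fintype.card V with hn
  have hφ0 : 0 < φ := by linarith
  have hsum : ∑ T : Finset V, (1 / φ) ^ #T = (1 / φ + 1) ^ n := by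
    have := Fintype.sum_pow_mul_eq_add_pow V (1 / φ) 1
    simpa using this
  calc (#{T : Finset V | φ * #T ≤ n} : ℝ)
      = ∑ T : Finset V with φ * #T ≤ n, (1 : ℝ) := by simp
    _ ≤ ∑ T : Finset V with φ * #T ≤ n, φ ^ (n / φ : ℝ) * (1 / φ) ^ #T := by
        refine sum_le_sum fun T hT => ?_
        have hT := (mem_filter.1 hT).2
        rw [one_div, inv_pow, ← div_eq_mul_inv, one_le_div (by positivity), ← Real.rpow_natCast]
        refine Real.rpow_le_rpow_of_exponent_le hφ ?_
        rw [le_div_iff₀ hφ0]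
        linarith
    _ ≤ ∑ T : Finset V, φ ^ (n / φ : ℝ) * (1 / φ) ^ #T :=
        sum_le_sum_of_subset_of_nonneg (filter_subset _ _) fun _ _ _ => by positivity
    _ = φ ^ (n / φ : ℝ) * (1 / φ + 1) ^ n := by rw [← mul_sum, hsum]
    _ ≤ Real.exp (Real.log φ * (n / φ)) * Real.exp (1 / φ) ^ n := by
        rw [Real.rpow_def_of_pos hφ0]
        gcongr
        exact Real.add_one_le_exp _
    _ = _ := by
        rw [← Real.exp_nat_mul, ← Real.exp_add]
        congr 1
        ring

end Containers

section ListColorings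

variable {V : Type*} [Fintype V] [DecidableEq V] {q : ℕ} (G : SimpleGraph V) [DecidableRel G.Adj]

/-- The proper colorings of `G` with colors from the lists `L`. -/
def listColorings (L : V → Finset (Fin q)) : Finset (V → Fin q) :=
  {f ∈ Fintype.piFinset L | ∀ v w, G.Adj v w → f v ≠ f w}

variable {G}

lemma card_listColorings_le_prod (L : V → Finset (Fin q)) :
    #(listColorings G L) ≤ ∏ v, #(L v) := by
  rw [← Fintype.card_piFinset]
  exact card_filter_le _ _

/-- Each edge of a matching inside the vertices whose lists contain the color `c` saves a
constant factor. -/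
theorem card_listColorings_le (hq : 0 < q) {α : ℕ}
    (hα : ∀ S : Finset V, α < #S → ∃ u ∈ S, ∃ v ∈ S, G.Adj u v) (c : Fin q) (k : ℕ)
    (L : V → Finset (Fin q)) (S : Finset V) (hS : ∀ v ∈ S, c ∈ L v) (hk : α + 2 * k ≤ #S + 1) :
    (#(listColorings G L) : ℝ) ≤ (∏ v, (#(L v) : ℝ)) * (1 - 1 / (q : ℝ) ^ 2) ^ k := by
  induction k generalizing L S with
  | zero =>
    rw [pow_zero, mul_one]
    exact_mod_cast card_listColorings_le_prod L
  | succ k ih =>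
  obtain ⟨u, hu, v, hv, huv⟩ := hα S (by omega)
  have hne : u ≠ v := huv.ne
  have hq1 : (1 : ℝ) ≤ q := by exact_mod_cast hq
  have hρ : (0 : ℝ) ≤ 1 - 1 / (q : ℝ) ^ 2 := by
    rw [sub_nonneg, div_le_one (by positivity)]
    exact one_le_pow₀ hq1
  set R : ℝ := ∏ w ∈ ({u, v} : Finset V)ᶜ, (#(L w) : ℝ) with hR
  have hR0 : 0 ≤ R := prod_nonneg fun _ _ => by positivity
  have hprod : ∏ w, (#(L w) : ℝ) = #(L u) * #(L v) * R := by
    rw [← prod_mul_prod_compl {u, v}, prod_pair hne]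
  have hmaps : ∀ f ∈ listColorings G L, (f u, f v) ∈ (L u ×ˢ L v).erase (c, c) := by
    intro f hf
    rw [listColorings, mem_filter, Fintype.mem_piFinset] at hf
    rw [mem_erase, mem_product]
    refine ⟨fun h => hf.2 u v huv ?_, hf.1 u, hf.1 v⟩
    rw [(Prod.mk.inj h).1, (Prod.mk.inj h).2]
  have hfib : ∀ ab ∈ (L u ×ˢ L v).erase (c, c),
      (#{f ∈ listColorings G L | (f u, f v) = ab} : ℝ) ≤ R * (1 - 1 / (q : ℝ) ^ 2) ^ k := by
    rintro ⟨a, b⟩ -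
    set L' : V → Finset (Fin q) := Function.update (Function.update L u {a}) v {b} with hL'
    have hL'u : L' u = {a} := by simp [hL', hne]
    have hL'v : L' v = {b} := by simp [hL']
    have hL'w : ∀ w, w ≠ u → w ≠ v → L' w = L w := fun w h1 h2 => by simp [hL', h1, h2]
    have hsub : {f ∈ listColorings G L | (f u, f v) = (a, b)} ⊆ listColorings G L' := by
      intro f hf
      simp only [listColorings, mem_filter, Fintype.mem_piFinset, Prod.mk.injEq] at hf ⊢
      refine ⟨fun w => ?_, hf.1.2⟩
      by_cases h1 : w = u
      · rw [h1, hL'u, mem_singleton]; exact hf.2.1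
      by_cases h2 : w = v
      · rw [h2, hL'v, mem_singleton]; exact hf.2.2
      · rw [hL'w w h1 h2]; exact hf.1.1 w
    have hcard : #S ≤ #(S \ {u, v}) + 2 := by
      have h1 := le_card_sdiff {u, v} S
      have h2 : #({u, v} : Finset V) ≤ 2 := card_le_two
      omega
    have h := ih L' (S \ {u, v}) (fun w hw => by
      simp only [mem_sdiff, mem_insert, mem_singleton, not_or] at hw
      rw [hL'w w hw.2.1 hw.2.2]
      exact hS w hw.1) (by omega)
    have hprod' : ∏ w, (#(L' w) : ℝ) = R := by
      rw [← prod_mul_prod_compl {u, v}, prod_pair hne, hL'u, hL'v, hR]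
      simp only [card_singleton, Nat.cast_one, one_mul]
      refine prod_congr rfl fun w hw => ?_
      simp only [mem_compl, mem_insert, mem_singleton, not_or] at hw
      rw [hL'w w hw.1 hw.2]
    rw [hprod'] at h
    refine le_trans ?_ h
    exact_mod_cast card_le_card hsub
  have hpairs : (#((L u ×ˢ L v).erase (c, c)) : ℝ) = #(L u) * #(L v) - 1 := by
    rw [cast_card_erase_of_mem (mem_product.2 ⟨hS u hu, hS v hv⟩), card_product]
    push_cast
    ring
  have hLq : ∀ w, (#(L w) : ℝ) ≤ q := fun w => by
    exact_mod_cast (card_le_univ (L w)).trans_eq (Fintype.card_fin q)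
  calc (#(listColorings G L) : ℝ)
      = ∑ ab ∈ (L u ×ˢ L v).erase (c, c), (#{f ∈ listColorings G L | (f u, f v) = ab} : ℝ) := by
        exact_mod_cast card_eq_sum_card_fiberwise hmaps
    _ ≤ (#(L u) * #(L v) - 1) * (R * (1 - 1 / (q : ℝ) ^ 2) ^ k) := by
        refine (sum_le_sum hfib).trans_eq ?_
        rw [sum_const, nsmul_eq_mul, hpairs]
    _ ≤ (#(L u) * #(L v) * (1 - 1 / (q : ℝ) ^ 2)) * (R * (1 - 1 / (q : ℝ) ^ 2) ^ k) := by
        refine mul_le_mul_of_nonneg_right ?_ (mul_nonneg hR0 (pow_nonneg hρ k))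
        have h1 : (#(L u) : ℝ) * #(L v) / (q : ℝ) ^ 2 ≤ 1 := by
          rw [div_le_one (by positivity), sq]
          exact mul_le_mul (hLq u) (hLq v) (Nat.cast_nonneg _) (Nat.cast_nonneg _)
        have h2 : (#(L u) * #(L v) * (1 - 1 / (q : ℝ) ^ 2)) =
          #(L u) * #(L v) - (#(L u) : ℝ) * #(L v) / (q : ℝ) ^ 2 := by ring
        linarith
    _ = _ := by rw [hprod, pow_succ]; ring

lemma le_div_pow_of_nat {a b k : ℕ} (ha : 0 < a) (hab : b = a + 1) :
    (k : ℝ) ≤ a * Real.exp (Real.log (b / a : ℝ) * (k - a : ℝ)) := by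
  have ha0 : (0 : ℝ) < a := by exact_mod_cast ha
  have hb0 : (0 : ℝ) < b := by rw [hab]; positivity
  have hba : (0 : ℝ) < b / a := by positivity
  rw [← Real.rpow_def_of_pos hba]
  rcases le_total a k with h | h
  · obtain ⟨t, rfl⟩ := Nat.exists_eq_add_of_le h
    have hB := one_add_mul_le_pow (a := (1 : ℝ) / a) (by
      have : (0 : ℝ) ≤ 1 / a := by positivity
      linarith) t
    rw [show ((a + t : ℕ) : ℝ) - a = (t : ℕ) by push_cast; ring, Real.rpow_natCast,
      show (b / a : ℝ) = 1 + 1 / a by rw [hab]; push_cast; field_simp]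
    calc ((a + t : ℕ) : ℝ) = a * (1 + t * (1 / a)) := by push_cast; field_simp
      _ ≤ _ := by gcongr
  · obtain ⟨t, rfl⟩ := Nat.exists_eq_add_of_le h
    have hkt : ((k + t : ℕ) : ℝ) = k + t := by push_cast; ring
    have hbR : (b : ℝ) = (k + t : ℕ) + 1 := by rw [hab]; push_cast; ring
    have hB := one_add_mul_le_pow (a := -(1 / (b : ℝ))) (by
      have : 1 / (b : ℝ) ≤ 1 := by
        rw [div_le_one hb0, hbR]; linarith
      linarith) (t + 1)
    rw [show (k : ℝ) - (k + t : ℕ) = -((t : ℕ) : ℝ) by push_cast; ring, Real.rpow_neg hba.le,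
      Real.rpow_natCast, ← inv_pow, inv_div]
    rw [show 1 + -(1 / (b : ℝ)) = (k + t : ℕ) / b by rw [hbR]; field_simp; ring, pow_succ] at hB
    have h2 := mul_le_mul_of_nonneg_right hB hb0.le
    calc (k : ℝ) = (1 + ((t + 1 : ℕ) : ℝ) * -(1 / (b : ℝ))) * b := by
          field_simp
          rw [hbR]
          push_cast
          ring
      _ ≤ _ := h2
      _ = _ := by field_simp

/-- A linear bound for the logarithm of a list size, tight at `⌊q/2⌋` and `⌈q/2⌉`. -/
lemma exists_forall_nat_le_sqrt_eta_mul_exp (hq : 3 ≤ q) :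
    ∃ l : ℝ, 0 < l ∧ ∀ k : ℕ, (k : ℝ) ≤ (eta q : ℝ) ^ (1 / 2 : ℝ) * Real.exp (l * (k - q / 2)) := by
  rcases Nat.even_or_odd' q with ⟨a, ha | ha⟩
  · have ha0 : (0 : ℝ) < a := by
      have : 0 < a := by omega
      exact_mod_cast this
    refine ⟨1 / a, by positivity, fun k => ?_⟩
    have hη : ((eta q : ℕ) : ℝ) = (a : ℝ) ^ 2 := by
      rw [eta, show q / 2 = a by omega, show (q + 1) / 2 = a by omega]
      push_cast
      ring
    rw [hη, ← Real.sqrt_eq_rpow, Real.sqrt_sq ha0.le]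
    have h1 := Real.add_one_le_exp (1 / (a : ℝ) * (k - q / 2))
    have hqa : (q : ℝ) / 2 = a := by rw [ha]; push_cast; ring
    rw [hqa] at h1 ⊢
    calc (k : ℝ) = a * (1 / (a : ℝ) * (k - a) + 1) := by field_simp; ring
      _ ≤ _ := by gcongr
  · have ha1 : 0 < a := by omega
    have ha0 : (0 : ℝ) < a := by exact_mod_cast ha1
    have hη : ((eta q : ℕ) : ℝ) = (a : ℝ) * ((a + 1 : ℕ) : ℝ) := by
      rw [eta, show q / 2 = a by omega, show (q + 1) / 2 = a + 1 by omega]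
      push_cast
      ring
    have hb0 : (0 : ℝ) < ((a + 1 : ℕ) : ℝ) := by positivity
    have hlog : 0 < Real.log (((a + 1 : ℕ) : ℝ) / a) := by
      refine Real.log_pos ?_
      rw [one_lt_div ha0]
      push_cast
      linarith
    refine ⟨_, hlog, fun k => (le_div_pow_of_nat (b := a + 1) ha1 rfl).trans (le_of_eq ?_)⟩
    have hη0 : (0 : ℝ) < eta q := by rw [hη]; positivity
    rw [Real.rpow_def_of_pos hη0, hη, ← Real.exp_add,
      Real.log_mul ha0.ne' hb0.ne', Real.log_div hb0.ne' ha0.ne']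
    nth_rewrite 1 [← Real.exp_log ha0]
    rw [← Real.exp_add]
    congr 1
    rw [show (q : ℝ) = 2 * a + 1 by rw [ha]; push_cast; ring]
    ring

end ListColorings

section Assembly

variable {V : Type*} [Fintype V] [DecidableEq V] {q : ℕ} {G : SimpleGraph V} [DecidableRel G.Adj]

lemma numColorings_le_sum_card_listColorings {φ : ℝ} (hφ : 0 < φ) :
    numColorings G q ≤
      ∑ 𝒯 ∈ Fintype.piFinset fun _ : Fin q => {T : Finset V | φ * #T ≤ Fintype.card V},
        #(listColorings G fun v => {c | v ∈ container G φ (𝒯 c)}) := by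
  have hcard : numColorings G q = #{f : V → Fin q | ∀ v w, G.Adj v w → f v ≠ f w} := by
    rw [numColorings, Nat.card_eq_fintype_card, Fintype.card_subtype]
  rw [hcard]
  refine le_trans (card_le_card fun f hf => ?_) card_biUnion_le
  have hf := (mem_filter.1 hf).2
  have hT : ∀ c : Fin q, ∃ T : Finset V, φ * #T ≤ Fintype.card V ∧
      ({v | f v = c} : Finset V) ⊆ container G φ T := by
    intro c
    obtain ⟨T, -, hT⟩ := exists_subset_container (G := G) hφ (I := {v | f v = c})
      fun u hu v hv huv => hf u v huv
        ((mem_filter.1 hu).2.trans (mem_filter.1 hv).2.symm)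
    exact ⟨T, hT⟩
  choose 𝒯 h𝒯 hsub using hT
  rw [mem_biUnion]
  refine ⟨𝒯, Fintype.mem_piFinset.2 fun c => mem_filter.2 ⟨mem_univ _, h𝒯 c⟩, ?_⟩
  rw [listColorings, mem_filter, Fintype.mem_piFinset]
  exact ⟨fun v => mem_filter.2 ⟨mem_univ _, hsub (f v) (mem_filter.2 ⟨mem_univ _, rfl⟩)⟩, hf⟩

lemma prod_card_le_of_forall_nat_le {V : Type*} [Fintype V] {l : ℝ}
    (hl : ∀ k : ℕ, (k : ℝ) ≤ (eta q : ℝ) ^ (1 / 2 : ℝ) * Real.exp (l * (k - q / 2)))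
    (L : V → Finset (Fin q)) :
    ∏ v, (#(L v) : ℝ) ≤ (eta q : ℝ) ^ ((Fintype.card V : ℝ) / 2) *
      Real.exp (l * (∑ c, (#{v | c ∈ L v} : ℝ) - q * Fintype.card V / 2)) := by
  have hsum : ∑ c, (#{v | c ∈ L v} : ℝ) = ∑ v, (#(L v) : ℝ) := by
    have := sum_card_bipartiteAbove_eq_sum_card_bipartiteBelow (s := (univ : Finset V))
      (t := (univ : Finset (Fin q))) fun v c => c ∈ L v
    simp only [bipartiteAbove, bipartiteBelow, filter_univ_mem] at this
    exact_mod_cast this.symm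
  calc ∏ v, (#(L v) : ℝ)
      ≤ ∏ v, (eta q : ℝ) ^ (1 / 2 : ℝ) * Real.exp (l * (#(L v) - q / 2)) :=
        prod_le_prod (fun _ _ => Nat.cast_nonneg _) fun v _ => hl _
    _ = _ := by
        rw [prod_mul_distrib, prod_const, card_univ, ← Real.exp_sum, ← mul_sum, sum_sub_distrib,
          sum_const, card_univ, hsum, ← Real.rpow_natCast, ← Real.rpow_mul (Nat.cast_nonneg _),
          nsmul_eq_mul, one_div_mul_eq_div, mul_div_left_comm, mul_div_assoc]

lemma card_listColorings_le_of_forall_isIndepSet_card_lt {l s ε : ℝ} (hq : 0 < q) (hl0 : 0 < l)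
    (hl : ∀ k : ℕ, (k : ℝ) ≤ (eta q : ℝ) ^ (1 / 2 : ℝ) * Real.exp (l * (k - q / 2)))
    (hs : 0 ≤ s) (hε : 0 ≤ ε)
    (hind : ∀ I : Finset V, (∀ u ∈ I, ∀ v ∈ I, ¬ G.Adj u v) →
      (#I : ℝ) < (1 - ε) * Fintype.card V / 2)
    (L : V → Finset (Fin q))
    (hL : ∀ c, (#{v | c ∈ L v} : ℝ) ≤ (1 + s) * Fintype.card V / 2) :
    (#(listColorings G L) : ℝ) ≤ (eta q : ℝ) ^ ((Fintype.card V : ℝ) / 2) *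
      Real.exp (l * q * s * Fintype.card V / 2 -
        min (l / 4) (1 / (8 * (q : ℝ) ^ 2)) * ε * Fintype.card V) := by
  set n : ℝ := (Fintype.card V : ℝ) with hn
  have hn0 : 0 ≤ n := Nat.cast_nonneg _
  have hq1 : (1 : ℝ) ≤ q := by exact_mod_cast hq
  have hεn : 0 ≤ ε * n := mul_nonneg hε hn0
  have hprod := prod_card_le_of_forall_nat_le hl L
  rw [← hn] at hprod
  set c : Fin q := ⟨0, hq⟩
  rcases lt_or_ge (#{v | c ∈ L v} : ℝ) ((1 - ε / 2) * n / 2) with hc | hc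
  · have hle : (#(listColorings G L) : ℝ) ≤ ∏ v, (#(L v) : ℝ) := by
      exact_mod_cast card_listColorings_le_prod L
    refine (hle.trans hprod).trans ?_
    gcongr
    have hsum : ∑ c, (#{v | c ∈ L v} : ℝ) ≤
        (1 - ε / 2) * n / 2 + (q - 1) * ((1 + s) * n / 2) := by
      rw [← add_sum_erase _ _ (mem_univ c)]
      refine add_le_add hc.le ((sum_le_card_nsmul _ _ _ fun c' _ => hL c').trans_eq ?_)
      rw [nsmul_eq_mul, card_erase_of_mem (mem_univ c), card_univ, Fintype.card_fin,
        Nat.cast_pred hq]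
    have h1 := mul_le_mul_of_nonneg_left hsum hl0.le
    have h2 := mul_le_mul_of_nonneg_right (min_le_left (l / 4) (1 / (8 * (q : ℝ) ^ 2))) hεn
    have h3 : 0 ≤ l * s * n := by positivity
    nlinarith
  · have hα0 : 0 < (1 - ε) * n / 2 := by simpa using hind ∅ (by simp)
    set α := ⌊(1 - ε) * n / 2⌋₊ with hα
    have hαle : (α : ℝ) ≤ (1 - ε) * n / 2 := Nat.floor_le hα0.le
    set S : Finset V := {v | c ∈ L v} with hS
    have hαS : α ≤ #S := by
      have : (α : ℝ) ≤ #S := by linarith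
      exact_mod_cast this
    have hk := card_listColorings_le (G := G) hq (α := α) (fun T hT => by
      by_contra! hcon
      have h1 := hind T hcon
      have h2 := Nat.lt_floor_add_one ((1 - ε) * n / 2)
      have h3 : (α : ℝ) + 1 ≤ #T := by exact_mod_cast hT
      linarith) c ((#S + 1 - α) / 2) L S (fun v hv => (mem_filter.1 hv).2) (by omega)
    set k := (#S + 1 - α) / 2 with hkdef
    have hkn : ε * n / 8 ≤ k := by
      have h1 : #S ≤ α + 2 * k := by omega
      have h2 : (#S : ℝ) ≤ α + 2 * k := by exact_mod_cast h1
      linarith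
    have hpow : (1 - 1 / (q : ℝ) ^ 2) ^ k ≤
        Real.exp (-(1 / (8 * (q : ℝ) ^ 2) * (ε * n))) := by
      have h0 : (0 : ℝ) ≤ 1 - 1 / (q : ℝ) ^ 2 := by
        rw [sub_nonneg, div_le_one (by positivity)]
        exact one_le_pow₀ hq1
      calc (1 - 1 / (q : ℝ) ^ 2) ^ k ≤ Real.exp (-(1 / (q : ℝ) ^ 2)) ^ k :=
            pow_le_pow_left₀ h0 (Real.one_sub_le_exp_neg _) k
        _ = Real.exp (-(k * (1 / (q : ℝ) ^ 2))) := by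
            rw [← Real.exp_nat_mul, mul_neg]
        _ ≤ _ := by
            rw [Real.exp_le_exp, neg_le_neg_iff]
            calc 1 / (8 * (q : ℝ) ^ 2) * (ε * n) = ε * n / 8 * (1 / (q : ℝ) ^ 2) := by
                  field_simp
              _ ≤ _ := mul_le_mul_of_nonneg_right hkn (by positivity)
    have hsum : ∑ c, (#{v | c ∈ L v} : ℝ) ≤ q * ((1 + s) * n / 2) := by
      refine (sum_le_card_nsmul _ _ _ fun c' _ => hL c').trans_eq ?_
      rw [nsmul_eq_mul, card_univ, Fintype.card_fin]
    calc (#(listColorings G L) : ℝ)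
        ≤ (∏ v, (#(L v) : ℝ)) * (1 - 1 / (q : ℝ) ^ 2) ^ k := hk
      _ ≤ ((eta q : ℝ) ^ (n / 2) *
            Real.exp (l * (∑ c, (#{v | c ∈ L v} : ℝ) - q * n / 2))) *
          Real.exp (-(1 / (8 * (q : ℝ) ^ 2) * (ε * n))) :=
          mul_le_mul hprod hpow (pow_nonneg (by
            rw [sub_nonneg, div_le_one (by positivity)]
            exact one_le_pow₀ hq1) k) (by positivity)
      _ ≤ _ := by
          rw [mul_assoc, ← Real.exp_add]
          gcongr
          have h1 := mul_le_mul_of_nonneg_left hsum hl0.le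
          have h2 := mul_le_mul_of_nonneg_right (min_le_right (l / 4) (1 / (8 * (q : ℝ) ^ 2))) hεn
          linarith

/-- A regular graph without large independent sets has at most `η(q) ^ (n / 2)` colorings. -/
theorem exists_numColorings_le_of_forall_isIndepSet_card_lt (hq : 3 ≤ q) :
    ∃ K : ℝ, 0 < K ∧ ∀ {V : Type*} [Fintype V] [DecidableEq V] (G : SimpleGraph V)
      [DecidableRel G.Adj] {d : ℕ} {s : ℝ}, 2 ≤ d → G.IsRegularOfDegree d → 0 < s → s ≤ 1 →
      d * s ^ 2 = Real.logb 2 d →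
      (∀ I : Finset V, (∀ u ∈ I, ∀ v ∈ I, ¬ G.Adj u v) →
        (#I : ℝ) < (1 - K * s) * Fintype.card V / 2) →
      (numColorings G q : ℝ) ≤ (eta q : ℝ) ^ ((Fintype.card V : ℝ) / 2) := by
  obtain ⟨l, hl0, hl⟩ := exists_forall_nat_le_sqrt_eta_mul_exp hq
  have hq0 : (0 : ℝ) < q := by
    have : 0 < q := by omega
    exact_mod_cast this
  set κ : ℝ := min (l / 4) (1 / (8 * (q : ℝ) ^ 2)) with hκ
  have hκ0 : 0 < κ := lt_min (by positivity) (by positivity)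
  refine ⟨(2 * q + l * q / 2) / κ, by positivity, ?_⟩
  intro V _ _ G _ d s hd hG hs hs1 hds hind
  set n : ℝ := (Fintype.card V : ℝ) with hn
  have hn0 : 0 ≤ n := Nat.cast_nonneg _
  have hd2 : (2 : ℝ) ≤ d := by exact_mod_cast hd
  have hlogb : 1 ≤ Real.logb 2 d := by
    rw [Real.le_logb_iff_rpow_le one_lt_two (by linarith), Real.rpow_one]
    exact hd2
  have hφ1 : 1 ≤ d * s := by nlinarith
  have hφ0 : 0 < d * s := by linarith
  have hlogφ : Real.log (d * s) ≤ Real.logb 2 d := by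
    have h1 : Real.log (d * s) ≤ Real.log d := Real.log_le_log hφ0 (by nlinarith)
    have h2 : Real.log d ≤ Real.logb 2 d := by
      rw [Real.logb, le_div_iff₀ (Real.log_pos one_lt_two)]
      have := Real.log_two_lt_d9
      have := Real.log_nonneg (show (1 : ℝ) ≤ d by linarith)
      nlinarith
    exact h1.trans h2
  have hcont : ∀ T : Finset V, (#(container G (d * s) T) : ℝ) ≤ (1 + s) * n / 2 := by
    intro T
    have h1 := card_container_mul_le hG (d * s) T
    rw [← hn] at h1
    have h2 : (#(container G (d * s) T) : ℝ) * (2 - s) ≤ n := by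
      refine le_of_mul_le_mul_left (a := (d : ℝ)) ?_ (by linarith)
      linarith
    have h3 : (0 : ℝ) ≤ #(container G (d * s) T) := Nat.cast_nonneg _
    have h4 := mul_le_mul_of_nonneg_left h2 (show 0 ≤ 1 + s by linarith)
    have h5 : 0 ≤ (#(container G (d * s) T) : ℝ) * (s * (1 - s)) :=
      mul_nonneg h3 (mul_nonneg hs.le (by linarith))
    linarith
  set F : Finset (Finset V) := {T : Finset V | d * s * #T ≤ n} with hF
  have hFcard : (#F : ℝ) ≤ Real.exp (2 * s * n) := by
    refine (card_filter_small_le hφ1).trans ?_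
    rw [Real.exp_le_exp, ← hn, div_mul_eq_mul_div, div_le_iff₀ hφ0]
    have : 1 + Real.log (d * s) ≤ 2 * (d * s ^ 2) := by linarith
    have := mul_le_mul_of_nonneg_left this hn0
    linarith
  set B : ℝ := (eta q : ℝ) ^ (n / 2) *
    Real.exp (l * q * s * n / 2 - κ * ((2 * q + l * q / 2) / κ * s) * n) with hB
  have hB0 : 0 ≤ B := by positivity
  calc (numColorings G q : ℝ)
      ≤ ∑ 𝒯 ∈ Fintype.piFinset fun _ : Fin q => F,
        (#(listColorings G fun v => {c | v ∈ container G (d * s) (𝒯 c)}) : ℝ) := by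
        exact_mod_cast numColorings_le_sum_card_listColorings (G := G) (q := q) hφ0
    _ ≤ ∑ 𝒯 ∈ Fintype.piFinset fun _ : Fin q => F, B := by
        refine sum_le_sum fun 𝒯 _ => ?_
        refine card_listColorings_le_of_forall_isIndepSet_card_lt (by omega) hl0 hl hs.le
          (by positivity) hind _ fun c => ?_
        simpa using hcont (𝒯 c)
    _ = (#F : ℝ) ^ q * B := by
        rw [sum_const, nsmul_eq_mul, Fintype.card_piFinset, prod_const, card_univ,
          Fintype.card_fin, Nat.cast_pow]
    _ ≤ Real.exp (2 * s * n) ^ q * B := by gcongr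
    _ = (eta q : ℝ) ^ (n / 2) := by
        rw [hB, mul_left_comm, ← Real.exp_nat_mul, ← Real.exp_add]
        convert mul_one _
        rw [Real.exp_eq_one_iff]
        field_simp
        ring

lemma two_le_mq (hq : 3 ≤ q) : 2 ≤ mq q := by
  have key : ∀ a, 0 < a → 2 ≤ Nat.choose (2 * a) a := Nat.two_le_centralBinom
  rw [mq]
  split_ifs with h
  · obtain ⟨a, rfl⟩ := h
    rw [← two_mul, Nat.mul_div_cancel_left _ two_pos]
    exact key a (by omega)
  · obtain ⟨a, rfl⟩ := Nat.not_even_iff_odd.1 h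
    rw [show 2 * a + 1 + 1 = 2 * (a + 1) by ring, Nat.mul_div_cancel_left _ two_pos]
    exact key _ (by omega)

end Assembly

theorem colorings_asymptotic_upper_bound (q : ℕ) (hq : 3 ≤ q) :
    ∃ C : ℝ, 0 < C ∧
      ∀ (d n : ℕ), 2 ≤ d → d + 1 ≤ n →
        ∀ (G : SimpleGraph (Fin n)) [DecidableRel G.Adj],
          G.IsRegularOfDegree d →
          (numColorings G q : ℝ) ≤
            (eta q : ℝ) ^ ((n : ℝ) / 2) *
              (mq q : ℝ) ^
                ((n : ℝ) / (2 * d) +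
                  C * n * Real.sqrt (Real.logb 2 d) / (d : ℝ) ^ ((3 : ℝ) / 2)) := by
  obtain ⟨K, hK, hcase⟩ := exists_numColorings_le_of_forall_isIndepSet_card_lt hq
  have hη0 : (0 : ℝ) < eta q := by
    have := two_le_eta hq
    exact_mod_cast (by omega : 0 < eta q)
  have hm2 : (2 : ℝ) ≤ mq q := by exact_mod_cast two_le_mq hq
  refine ⟨K / 2 + 2 * (2 ^ q * (2 * K + 2 * eta q)), by positivity, ?_⟩
  intro d n hd hdn G _ hG
  have hd2 : (2 : ℝ) ≤ d := by exact_mod_cast hd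
  have hd0 : (0 : ℝ) < d := by linarith
  have hn0 : (0 : ℝ) ≤ n := Nat.cast_nonneg _
  have hlogb1 : 1 ≤ Real.logb 2 d := by
    rw [Real.le_logb_iff_rpow_le one_lt_two hd0, Real.rpow_one]
    exact hd2
  have hlogbd : Real.logb 2 d ≤ d := by
    rw [Real.logb_le_iff_le_rpow one_lt_two hd0, Real.rpow_natCast]
    exact_mod_cast Nat.lt_two_pow_self.le
  set s : ℝ := Real.sqrt (Real.logb 2 d / d) with hsdef
  have hs : 0 < s := Real.sqrt_pos.2 (by positivity)
  have hs1 : s ≤ 1 := Real.sqrt_le_one.2 ((div_le_one hd0).2 hlogbd)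
  have hs2 : s ^ 2 = Real.logb 2 d / d := Real.sq_sqrt (by positivity)
  have hds : d * s ^ 2 = Real.logb 2 d := by rw [hs2, mul_div_cancel₀ _ hd0.ne']
  have hinv : 1 / d ≤ s := by
    rw [div_le_iff₀ hd0]
    nlinarith
  have hexp : ∀ C : ℝ, C * n * Real.sqrt (Real.logb 2 d) / (d : ℝ) ^ ((3 : ℝ) / 2) =
      C * n * s / d := by
    intro C
    rw [hsdef, Real.sqrt_div (by positivity), show (3 : ℝ) / 2 = 1 + 1 / 2 by norm_num,
      Real.rpow_add hd0, Real.rpow_one, ← Real.sqrt_eq_rpow]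
    field_simp
  rw [hexp]
  set C : ℝ := K / 2 + 2 * (2 ^ q * (2 * K + 2 * eta q)) with hC
  by_cases hind : ∀ I : Finset (Fin n), (∀ u ∈ I, ∀ v ∈ I, ¬ G.Adj u v) →
      (#I : ℝ) < (1 - K * s) * n / 2
  · have h := hcase G hd hG hs hs1 hds (by simpa using hind)
    rw [Fintype.card_fin] at h
    refine h.trans (le_mul_of_one_le_right (by positivity) ?_)
    exact Real.one_le_rpow (by linarith) (by positivity)
  · push Not at hind
    obtain ⟨I, hI, hcard⟩ := hind
    have h := numColorings_le_of_isIndepSet (by omega) hG hq hI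
    rw [Fintype.card_fin] at h
    set x : ℝ := 2 ^ q / d * (2 * (n - 2 * #I) + 2 * eta q * n / d) with hx
    have hxle : x ≤ 2 ^ q * (2 * K + 2 * eta q) * n * s / d := by
      have h1 : 2 * eta q * n / d ≤ 2 * eta q * n * s := by
        have := mul_le_mul_of_nonneg_left hinv (by positivity : 0 ≤ 2 * (eta q : ℝ) * n)
        rwa [mul_one_div] at this
      calc x ≤ 2 ^ q / d * (2 * (K * s * n) + 2 * eta q * n * s) := by
            rw [hx]
            gcongr
            linarith
        _ = _ := by ring
    have hexpx : Real.exp x ≤ (mq q : ℝ) ^ (2 * (2 ^ q * (2 * K + 2 * eta q) * n * s / d)) := by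
      rw [Real.rpow_def_of_pos (by linarith), Real.exp_le_exp]
      have hlog : 1 / 2 ≤ Real.log (mq q) := by
        have h1 := Real.log_two_gt_d9
        have h2 := Real.log_le_log two_pos hm2
        linarith
      have := mul_le_mul_of_nonneg_right hlog
        (by positivity : 0 ≤ 2 * (2 ^ q * (2 * K + 2 * eta q) * n * s / d))
      linarith
    have hm0 : (0 : ℝ) < mq q := by linarith
    calc (numColorings G q : ℝ)
        ≤ (eta q : ℝ) ^ (n / 2 : ℝ) * (mq q : ℝ) ^ ((n - #I) / d : ℝ) * Real.exp x := h
      _ ≤ (eta q : ℝ) ^ (n / 2 : ℝ) * (mq q : ℝ) ^ (((1 + K * s) * n / 2) / d : ℝ) *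
          (mq q : ℝ) ^ (2 * (2 ^ q * (2 * K + 2 * eta q) * n * s / d)) := by
          gcongr
          · linarith
          · linarith
      _ = _ := by
          rw [mul_assoc, ← Real.rpow_add hm0, hC]
          congr 2
          field_simp
          ring
end

section
/- Let a₁, …, a_m be positive real numbers with average a, and suppose there is a real δ ≥ 0 such that no a_i lies in the open interval (a−δ, a+δ). Then the product satisfies ∏_{i=1}^m a_i ≤ (a² − δ²)^{m/2} = (a−δ)^{m/2}(a+δ)^{m/2}. -/
/-- Outside `(u, v)` the logarithm lies below its chord over `[u, v]`
(its tangent line at `u` if `u = v`). -/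
theorem exists_log_le_chord {u v : ℝ} (hu : 0 < u) (huv : u ≤ v) :
    ∃ c : ℝ, Real.log v = Real.log u + c * (v - u) ∧
      ∀ x, 0 < x → x ∉ Set.Ioo u v → Real.log x ≤ Real.log u + c * (x - u) := by
  rcases huv.eq_or_lt with rfl | huv
  · refine ⟨u⁻¹, by simp, fun x hx _ => ?_⟩
    have h := Real.log_le_sub_one_of_pos (div_pos hx hu)
    rw [Real.log_div hx.ne' hu.ne'] at h
    have e : u⁻¹ * (x - u) = x / u - 1 := by field_simp
    linarith
  · have hvu : 0 < v - u := sub_pos.2 huv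
    have hconc := strictConcaveOn_log_Ioi.concaveOn
    have hc : (Real.log v - Real.log u) / (v - u) * (v - u) = Real.log v - Real.log u :=
      div_mul_cancel₀ _ hvu.ne'
    refine ⟨(Real.log v - Real.log u) / (v - u), by linarith, fun x hx hgap => ?_⟩
    rcases lt_trichotomy x u with hxu | rfl | hux
    · have h := hconc.slope_anti_adjacent hx (hu.trans huv) hxu huv
      rw [le_div_iff₀ (sub_pos.2 hxu)] at h
      linarith
    · simp
    · have hvx : v ≤ x := not_lt.1 fun hxv => hgap ⟨hux, hxv⟩
      rcases hvx.eq_or_lt with rfl | hvx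
      · linarith
      · have h := hconc.slope_anti_adjacent hu hx huv hvx
        rw [div_le_iff₀ (sub_pos.2 hvx)] at h
        linarith

theorem optimization_lemma (m : ℕ) (hm : 1 ≤ m) (f : Fin m → ℝ) (hf : ∀ i, 0 < f i)
    (a δ : ℝ) (ha : a = (∑ i, f i) / m) (hδ : 0 ≤ δ)
    (hgap : ∀ i, f i ∉ Set.Ioo (a - δ) (a + δ)) :
    (∏ i, f i) ≤ (a ^ 2 - δ ^ 2) ^ ((m : ℝ) / 2) ∧
      (a ^ 2 - δ ^ 2) ^ ((m : ℝ) / 2) =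
        (a - δ) ^ ((m : ℝ) / 2) * (a + δ) ^ ((m : ℝ) / 2) := by
  have hm₀ : (0 : ℝ) < m := by exact_mod_cast hm
  have hne : (Finset.univ : Finset (Fin m)).Nonempty := ⟨⟨0, hm⟩, Finset.mem_univ _⟩
  have hsum : ∑ i, f i = m * a := by rw [ha]; field_simp
  have hu : 0 < a - δ := by
    rcases hδ.eq_or_lt with rfl | hδ
    · have : 0 < ∑ i, f i := Finset.sum_pos (fun i _ => hf i) hne
      rw [sub_zero, ha]
      positivity
    · obtain ⟨i, -, hi⟩ : ∃ i ∈ Finset.univ, f i ≤ a :=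
        Finset.exists_le_of_sum_le hne (by simp [hsum])
      by_contra! h
      exact hgap i ⟨h.trans_lt (hf i), by linarith⟩
  have hv : 0 < a + δ := by linarith
  have hfactor : a ^ 2 - δ ^ 2 = (a - δ) * (a + δ) := by ring
  refine ⟨?_, by rw [hfactor, Real.mul_rpow hu.le hv.le]⟩
  obtain ⟨c, hc, hlog⟩ := exists_log_le_chord hu (show a - δ ≤ a + δ by linarith)
  have hpos : 0 < a ^ 2 - δ ^ 2 := hfactor ▸ mul_pos hu hv
  rw [← Real.log_le_log_iff (Finset.prod_pos fun i _ => hf i) (Real.rpow_pos_of_pos hpos _),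
    Real.log_prod fun i _ => (hf i).ne', Real.log_rpow hpos, hfactor,
    Real.log_mul hu.ne' hv.ne', hc]
  calc ∑ i, Real.log (f i)
      ≤ ∑ i, (Real.log (a - δ) + c * (f i - (a - δ))) :=
        Finset.sum_le_sum fun i _ => hlog _ (hf i) (hgap i)
    _ = m / 2 * (Real.log (a - δ) + (Real.log (a - δ) + c * (a + δ - (a - δ)))) := by
        simp only [Finset.sum_add_distrib, ← Finset.mul_sum, Finset.sum_sub_distrib, hsum,
          Finset.sum_const, Finset.card_univ, Fintype.card_fin, nsmul_eq_mul]
        ring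
end

section
/- Let G be a simple d-regular graph on n vertices, let φ be a real number with 0 < φ < d, and let I be a nonempty independent set in G. Then there exists a nonempty subset T ⊆ I with |T| ≤ n/φ such that, setting D(T) = { v ∈ V(G) \ N(T) : |N(v) \ N(T)| < φ } (where N(S) denotes the union of the open neighborhoods of the vertices of S), we have I ⊆ D(T) and |D(T)| ≤ nd/(2d − φ). -/
/-- Double counting of the edges between `D` and `N`, in a `d`-regular graph, when every vertex
of `D` has fewer than `φ` neighbors outside `N`. -/
theorem SimpleGraph.IsRegularOfDegree.card_mul_sub_le {V : Type*} [Fintype V] [DecidableEq V]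
    {G : SimpleGraph V} [DecidableRel G.Adj] {d : ℕ} (hreg : G.IsRegularOfDegree d) {φ : ℝ}
    {D N : Finset V} (hD : ∀ v ∈ D, ((G.neighborFinset v \ N).card : ℝ) < φ) :
    (D.card : ℝ) * (d - φ) ≤ N.card * d := by
  have hcount : ∑ v ∈ D, (G.neighborFinset v ∩ N).card =
      ∑ u ∈ N, (G.neighborFinset u ∩ D).card := by
    convert Finset.sum_card_bipartiteAbove_eq_sum_card_bipartiteBelow (s := D) (t := N) G.Adj
      using 3 with v _ u _
    · ext u
      simp [Finset.bipartiteAbove, and_comm]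
    · ext v
      simp [Finset.bipartiteBelow, and_comm, G.adj_comm]
  have hlower : (D.card : ℝ) * (d - φ) ≤ ∑ v ∈ D, ((G.neighborFinset v ∩ N).card : ℝ) := by
    rw [← nsmul_eq_mul]
    refine Finset.card_nsmul_le_sum _ _ _ fun v hv => ?_
    have hsplit := Finset.card_sdiff_add_card_inter (G.neighborFinset v) N
    rw [G.card_neighborFinset_eq_degree, hreg v] at hsplit
    have hsplit' : ((G.neighborFinset v \ N).card : ℝ) + (G.neighborFinset v ∩ N).card = d := by
      exact_mod_cast hsplit
    linarith [hD v hv]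
  have hupper : ∑ u ∈ N, (G.neighborFinset u ∩ D).card ≤ N.card * d := by
    rw [← smul_eq_mul]
    refine Finset.sum_le_card_nsmul _ _ _ fun u _ => ?_
    rw [← hreg u, ← G.card_neighborFinset_eq_degree]
    exact Finset.card_le_card Finset.inter_subset_left
  refine hlower.trans ?_
  exact_mod_cast hcount.trans_le hupper

/-- A set `T ⊆ I` that is maximal subject to `φ * |T| ≤ |N(T)|` leaves every vertex of `I` with
fewer than `φ` neighbors outside `N(T)`. -/
theorem SimpleGraph.exists_subset_card_neighborFinset_sdiff_lt {V : Type*} [Fintype V]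
    [DecidableEq V] (G : SimpleGraph V) [DecidableRel G.Adj] {φ : ℝ} (hφ : 0 < φ)
    (I : Finset V) :
    ∃ T ⊆ I, φ * T.card ≤ (T.biUnion fun u => G.neighborFinset u).card ∧
      ∀ v ∈ I, ((G.neighborFinset v \ T.biUnion fun u => G.neighborFinset u).card : ℝ) < φ := by
  classical
  obtain ⟨T, hT, hmax⟩ := Finset.exists_max_image
    (I.powerset.filter fun T => φ * T.card ≤ (T.biUnion fun u => G.neighborFinset u).card)
    Finset.card ⟨∅, by simp⟩
  rw [Finset.mem_filter, Finset.mem_powerset] at hT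
  refine ⟨T, hT.1, hT.2, fun v hv => ?_⟩
  by_contra! hlarge
  have hvT : v ∉ T := by
    intro hvT
    rw [Finset.sdiff_eq_empty_iff_subset.2
      (Finset.subset_biUnion_of_mem (fun u => G.neighborFinset u) hvT)] at hlarge
    simp only [Finset.card_empty, Nat.cast_zero] at hlarge
    linarith
  have hinsert := hmax (insert v T) (by
    rw [Finset.mem_filter, Finset.mem_powerset]
    refine ⟨Finset.insert_subset hv hT.1, ?_⟩
    rw [Finset.biUnion_insert, ← Finset.card_sdiff_add_card, Finset.card_insert_of_notMem hvT]
    push_cast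
    linarith [hT.2])
  rw [Finset.card_insert_of_notMem hvT] at hinsert
  omega

theorem sapozhenko_container (V : Type*) [Fintype V] [DecidableEq V] (n d : ℕ)
    (hn : Fintype.card V = n)
    (G : SimpleGraph V) [DecidableRel G.Adj] (hreg : G.IsRegularOfDegree d)
    (φ : ℝ) (hφ0 : 0 < φ) (hφd : φ < d)
    (I : Finset V) (hInd : ∀ v ∈ I, ∀ w ∈ I, ¬ G.Adj v w) (hIne : I.Nonempty) :
    ∃ T : Finset V, T ⊆ I ∧ T.Nonempty ∧ (T.card : ℝ) ≤ n / φ ∧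
      (↑I : Set V) ⊆
        {v : V | v ∉ T.biUnion (fun u => G.neighborFinset u) ∧
          ((G.neighborFinset v \ T.biUnion (fun u => G.neighborFinset u)).card : ℝ) < φ} ∧
      (({v : V | v ∉ T.biUnion (fun u => G.neighborFinset u) ∧
          ((G.neighborFinset v \ T.biUnion (fun u => G.neighborFinset u)).card : ℝ) < φ}).ncard : ℝ) ≤
        n * d / (2 * d - φ) := by
  classical
  obtain ⟨T, hTI, hTcard, hsmall⟩ := G.exists_subset_card_neighborFinset_sdiff_lt hφ0 I
  set N := T.biUnion (fun u => G.neighborFinset u) with hN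
  have hNn : (N.card : ℝ) ≤ n := by
    rw [← hn]
    exact_mod_cast N.card_le_univ
  refine ⟨T, hTI, ?_, ?_, fun v hv => ⟨?_, hsmall v hv⟩, ?_⟩
  · rw [Finset.nonempty_iff_ne_empty]
    rintro rfl
    obtain ⟨v, hv⟩ := hIne
    have hlt := hsmall v hv
    rw [hN, Finset.biUnion_empty, Finset.sdiff_empty, G.card_neighborFinset_eq_degree,
      hreg v] at hlt
    linarith
  · rw [le_div_iff₀ hφ0]
    linarith
  · rw [Finset.mem_biUnion]
    rintro ⟨u, hu, huv⟩
    exact hInd u (hTI hu) v hv ((G.mem_neighborFinset u v).1 huv)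
  · have hset : {v : V | v ∉ N ∧ ((G.neighborFinset v \ N).card : ℝ) < φ} =
        ↑(Finset.univ.filter fun v => v ∉ N ∧ ((G.neighborFinset v \ N).card : ℝ) < φ) := by
      ext v
      simp
    rw [hset, Set.ncard_coe_finset]
    set D := Finset.univ.filter fun v => v ∉ N ∧ ((G.neighborFinset v \ N).card : ℝ) < φ
    have hedges : (D.card : ℝ) * (d - φ) ≤ N.card * d :=
      hreg.card_mul_sub_le fun v hv => (Finset.mem_filter.1 hv).2.2
    have hdisj : Disjoint D N :=
      Finset.disjoint_left.2 fun v hv => (Finset.mem_filter.1 hv).2.1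
    have hsum : (D.card : ℝ) + N.card ≤ n := by
      rw [← hn]
      exact_mod_cast (Finset.card_union_of_disjoint hdisj).symm.trans_le (D ∪ N).card_le_univ
    rw [le_div_iff₀ (by linarith)]
    linarith [mul_le_mul_of_nonneg_right hsum (Nat.cast_nonneg (α := ℝ) d)]
end

section
/- Let G be a simple graph on n vertices with maximum degree at most d, let φ be a real number with 0 ≤ φ < 2d, and let A and B be disjoint sets of vertices of G such that every vertex of A has at least d − φ neighbors in B. Then |A| ≤ nd/(2d − φ). -/
/-- Double counting of the edges between `A` and `B`: at most `d` of them meet each vertex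
of `B`. -/
lemma SimpleGraph.sum_card_neighborFinset_inter_le {V : Type*} [Fintype V] [DecidableEq V]
    (G : SimpleGraph V) [DecidableRel G.Adj] {d : ℕ} (hdeg : ∀ v, G.degree v ≤ d)
    (A B : Finset V) :
    ∑ v ∈ A, (G.neighborFinset v ∩ B).card ≤ B.card * d := by
  calc ∑ v ∈ A, (G.neighborFinset v ∩ B).card
      = ∑ v ∈ A, (B.bipartiteAbove G.Adj v).card := by
        refine Finset.sum_congr rfl fun v _ => congrArg Finset.card ?_
        ext w
        simp [Finset.bipartiteAbove, and_comm]
    _ = ∑ w ∈ B, (A.bipartiteBelow G.Adj w).card :=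
        Finset.sum_card_bipartiteAbove_eq_sum_card_bipartiteBelow G.Adj
    _ ≤ ∑ _w ∈ B, d := by
        refine Finset.sum_le_sum fun w _ => le_trans (Finset.card_le_card ?_) (hdeg w)
        intro v hv
        simpa using ((Finset.mem_bipartiteBelow G.Adj).1 hv).2.symm
    _ = B.card * d := by simp

theorem degree_count_bound (V : Type*) [Fintype V] [DecidableEq V] (n d : ℕ)
    (hn : Fintype.card V = n)
    (G : SimpleGraph V) [DecidableRel G.Adj] (hdeg : ∀ v, G.degree v ≤ d)
    (φ : ℝ) (hφ0 : 0 ≤ φ) (hφ : φ < 2 * d)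
    (A B : Finset V) (hAB : Disjoint A B)
    (hA : ∀ v ∈ A, (d : ℝ) - φ ≤ ((G.neighborFinset v ∩ B).card : ℝ)) :
    (A.card : ℝ) ≤ n * d / (2 * d - φ) := by
  have lower : (A.card : ℝ) * (d - φ) ≤ ∑ v ∈ A, ((G.neighborFinset v ∩ B).card : ℝ) := by
    simpa using Finset.card_nsmul_le_sum A _ _ hA
  have upper : ∑ v ∈ A, ((G.neighborFinset v ∩ B).card : ℝ) ≤ B.card * d := by
    exact_mod_cast G.sum_card_neighborFinset_inter_le hdeg A B
  have card_add : (A.card : ℝ) + B.card ≤ n := by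
    rw [← hn]
    exact_mod_cast Finset.card_union_of_disjoint hAB ▸ Finset.card_le_univ (A ∪ B)
  rw [le_div_iff₀ (by linarith)]
  have := mul_le_mul_of_nonneg_right card_add (Nat.cast_nonneg (α := ℝ) d)
  linarith
end

section
/- Let q ≥ 3 be an odd integer, let s be a real number with 0 ≤ s ≤ 1/2, and let a₁, …, a_m be positive integers whose average a = (a₁ + ⋯ + a_m)/m satisfies q/2 ≤ a ≤ q/2 + s. Then ∏_{i=1}^m a_i ≤ ((q−1)/2 + 2s)^{m/2} · ((q+1)/2)^{m/2}. -/
/-- At the positive integers, `log` lies below its chord through two consecutive integers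
`k` and `k + 1`. -/
theorem Real.log_natCast_le_chord {k n : ℕ} (hk : 0 < k) (hn : 0 < n) :
    Real.log n ≤ Real.log k + ((n : ℝ) - k) * (Real.log (k + 1) - Real.log k) := by
  have hk' : (0 : ℝ) < k := by exact_mod_cast hk
  have hn' : (0 : ℝ) < n := by exact_mod_cast hn
  rcases le_total k n with h | h
  · obtain ⟨j, rfl⟩ := Nat.exists_eq_add_of_le h
    have bernoulli := one_add_mul_le_pow (a := 1 / (k : ℝ))
      (by linarith [one_div_pos.mpr hk']) j
    have e₁ : 1 + (j : ℝ) * (1 / k) = ((k + j : ℕ) : ℝ) / k := by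
      push_cast
      field_simp
    have e₂ : 1 + 1 / (k : ℝ) = (k + 1) / k := by field_simp
    rw [e₁, e₂] at bernoulli
    have hlog := Real.log_le_log (by positivity) bernoulli
    rw [Real.log_pow, Real.log_div hn'.ne' hk'.ne', Real.log_div (by positivity) hk'.ne'] at hlog
    push_cast at hlog ⊢
    linarith
  · obtain ⟨j, rfl⟩ := Nat.exists_eq_add_of_le h
    have hj : (0 : ℝ) ≤ j := j.cast_nonneg
    have bernoulli := one_add_mul_le_pow (a := -(1 / (((n + j : ℕ) : ℝ) + 1)))
      (by
        have : 1 / (((n + j : ℕ) : ℝ) + 1) ≤ 1 := by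
          rw [div_le_one (by positivity)]
          linarith
        linarith) j
    have e₁ : (n : ℝ) / (n + j : ℕ) ≤ 1 + (j : ℝ) * -(1 / (((n + j : ℕ) : ℝ) + 1)) := by
      have e : 1 + (j : ℝ) * -(1 / (((n + j : ℕ) : ℝ) + 1)) =
          (n + 1) / (((n + j : ℕ) : ℝ) + 1) := by
        push_cast
        field_simp
        ring
      rw [e, div_le_div_iff₀ hk' (by positivity)]
      push_cast
      nlinarith
    have e₂ : 1 + -(1 / (((n + j : ℕ) : ℝ) + 1)) =
        ((n + j : ℕ) : ℝ) / (((n + j : ℕ) : ℝ) + 1) := by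
      field_simp
      ring
    rw [e₂] at bernoulli
    have hlog := Real.log_le_log (by positivity) (e₁.trans bernoulli)
    rw [Real.log_pow, Real.log_div hn'.ne' hk'.ne', Real.log_div hk'.ne' (by positivity)] at hlog
    push_cast at hlog ⊢
    linarith

theorem product_bound_odd_q (q : ℕ) (hq : 3 ≤ q) (hodd : Odd q)
    (s : ℝ) (hs0 : 0 ≤ s) (hs : s ≤ 1 / 2)
    (m : ℕ) (hm : 1 ≤ m) (f : Fin m → ℕ) (hf : ∀ i, 0 < f i)
    (havg_lb : (q : ℝ) / 2 ≤ (∑ i, (f i : ℝ)) / m)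
    (havg_ub : (∑ i, (f i : ℝ)) / m ≤ (q : ℝ) / 2 + s) :
    (∏ i, (f i : ℝ)) ≤
      (((q : ℝ) - 1) / 2 + 2 * s) ^ ((m : ℝ) / 2) *
        (((q : ℝ) + 1) / 2) ^ ((m : ℝ) / 2) := by
  obtain ⟨k, rfl⟩ := hodd
  have hk : 0 < k := by omega
  have hk' : (0 : ℝ) < k := by exact_mod_cast hk
  have hm' : (0 : ℝ) < m := by exact_mod_cast hm
  have hf' : ∀ i, (0 : ℝ) < f i := fun i => by exact_mod_cast hf i
  have eA : (((2 * k + 1 : ℕ) : ℝ) - 1) / 2 + 2 * s = k + 2 * s := by push_cast; ring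
  have eB : (((2 * k + 1 : ℕ) : ℝ) + 1) / 2 = k + 1 := by push_cast; ring
  rw [eA, eB]
  have hsum : ∑ i, (f i : ℝ) ≤ m * (k + 1 / 2 + s) := by
    rw [div_le_iff₀ hm'] at havg_ub
    push_cast at havg_ub
    linarith
  have hchord : ∑ i, Real.log (f i) ≤
      m * Real.log k + (∑ i, (f i : ℝ) - m * k) * (Real.log (k + 1) - Real.log k) := by
    refine (Finset.sum_le_sum fun i _ => Real.log_natCast_le_chord hk (hf i)).trans_eq ?_
    simp [Finset.sum_add_distrib, ← Finset.sum_mul]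
  have hstep : 0 ≤ Real.log (k + 1) - Real.log k :=
    sub_nonneg.mpr (Real.log_le_log hk' (by linarith))
  have hconcave : (1 - 2 * s) * Real.log k + 2 * s * Real.log (k + 1) ≤ Real.log (k + 2 * s) := by
    have h := strictConcaveOn_log_Ioi.concaveOn.2 (Set.mem_Ioi.mpr hk')
      (Set.mem_Ioi.mpr (by positivity : (0 : ℝ) < k + 1))
      (by linarith : 0 ≤ 1 - 2 * s) (by linarith : 0 ≤ 2 * s) (by ring)
    simp only [smul_eq_mul] at h
    rwa [show (1 - 2 * s) * (k : ℝ) + 2 * s * (k + 1) = k + 2 * s by ring] at h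
  have hslope := mul_le_mul_of_nonneg_right hsum hstep
  have hscaled := mul_le_mul_of_nonneg_left hconcave hm'.le
  rw [← Real.log_le_log_iff (Finset.prod_pos fun i _ => hf' i) (by positivity),
    Real.log_prod fun i _ => (hf' i).ne', Real.log_mul (by positivity) (by positivity),
    Real.log_rpow (by positivity), Real.log_rpow (by positivity)]
  linarith
end
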